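/- arXiv:1703.09513 — 5 statements merged into one kernel-verified Lean document; each statement's English description precedes it below -/
import Mathlib

section
/- Let (T, I, R) be a binary dataset with finite sets T and I, let Y ⊆ I, let Z ⊆ I be an itemset and let S ⊆ T. If Z is closed in the subdataset (S, I, R), i.e., d(t(Z) ∩ S) = Z, then the projected itemset Z \ Y is closed in the projected subdataset (S, I \ Y, R), i.e., d(t(Z \ Y) ∩ S) \ Y = Z \ Y. -/
/-- For a transaction `t`, its description `δ(t) = {i ∈ I : R t i}`. -/
def itemsOf {τ ι : Type*} [Fintype ι] (R : τ → ι → Prop) [∀ t i, Decidable (R t i)]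
    (t : τ) : Finset ι :=
  Finset.univ.filter (fun i => R t i)

/-- `d(A) = ⋂_{t ∈ A} δ(t)`, with `d(∅) = I`. -/
def dOp {τ ι : Type*} [Fintype ι] (R : τ → ι → Prop) [∀ t i, Decidable (R t i)]
    (A : Finset τ) : Finset ι :=
  Finset.univ.filter (fun i => ∀ t ∈ A, R t i)

/-- `t(X) = {t ∈ T : X ⊆ δ(t)}`. -/
def tOp {τ ι : Type*} [Fintype τ] (R : τ → ι → Prop) [∀ t i, Decidable (R t i)]
    (X : Finset ι) : Finset τ :=
  Finset.univ.filter (fun t => ∀ i ∈ X, R t i)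

/-- If an itemset `Z` is closed in the subdataset `(S, I, R)`, i.e.
`d(t(Z) ∩ S) = Z`, then the projected itemset `Z \ Y` is closed in the
projected subdataset `(S, I \ Y, R)`, i.e. `d(t(Z \ Y) ∩ S) \ Y = Z \ Y`. -/
theorem projected_closed_in_projected_subdataset
    {τ ι : Type*} [Fintype τ] [Fintype ι] [DecidableEq τ] [DecidableEq ι]
    (R : τ → ι → Prop) [∀ t i, Decidable (R t i)]
    (Y Z : Finset ι) (S : Finset τ)
    (hclosed : dOp R (tOp R Z ∩ S) = Z) :
    dOp R (tOp R (Z \ Y) ∩ S) \ Y = Z \ Y := by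
  ext i
  simp only [Finset.mem_sdiff]
  refine and_congr_left fun hY => ⟨fun h => ?_, fun h => ?_⟩
  · rw [← hclosed]
    simp only [dOp, tOp, Finset.mem_filter, Finset.mem_univ, true_and, Finset.mem_inter,
      Finset.mem_sdiff] at h ⊢
    exact fun t ht => h t ⟨fun j hj => ht.1 j hj.1, ht.2⟩
  · simp only [dOp, tOp, Finset.mem_filter, Finset.mem_univ, true_and, Finset.mem_inter,
      Finset.mem_sdiff]
    exact fun t ht => ht.1 i ⟨h, hY⟩
end

section
/- Stability is anti-monotonic with respect to any projection removing a set of items: let (T, I, R) be a binary dataset with finite sets T and I, let Y ⊆ I, let X ⊆ I \ Y, and let Z ⊆ I be any preimage of X under the projection removing Y, i.e., Z \ Y = X. Then the stability of X computed in the projected dataset (T, I \ Y, R) is at least the stability of Z computed in (T, I, R): 2^{−|T|} · |{S ⊆ T : d(t(X) ∩ S) \ Y = X}| ≥ 2^{−|T|} · |{S ⊆ T : d(t(Z) ∩ S) = Z}|. -/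
/-- Stability of `Z` in `(T, I, R)`: `2^{-|T|}` times the number of subdatasets
`S ⊆ T` in which `Z` is closed, i.e. `d(t(Z) ∩ S) = Z`. -/
noncomputable def stab {τ ι : Type*} [Fintype τ] [Fintype ι] [DecidableEq τ] [DecidableEq ι]
    (R : τ → ι → Prop) [∀ t i, Decidable (R t i)] (Z : Finset ι) : ℝ :=
  ((Finset.univ.filter (fun S : Finset τ => dOp R (tOp R Z ∩ S) = Z)).card : ℝ) /
    2 ^ (Fintype.card τ)

/-- Stability of `X ⊆ I \ Y` in the projected dataset `(T, I \ Y, R)`: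
`2^{-|T|}` times the number of `S ⊆ T` with `d(t(X) ∩ S) \ Y = X`. -/
noncomputable def stabProj {τ ι : Type*} [Fintype τ] [Fintype ι] [DecidableEq τ] [DecidableEq ι]
    (R : τ → ι → Prop) [∀ t i, Decidable (R t i)] (Y X : Finset ι) : ℝ :=
  ((Finset.univ.filter (fun S : Finset τ => dOp R (tOp R X ∩ S) \ Y = X)).card : ℝ) /
    2 ^ (Fintype.card τ)

/-- Stability is anti-monotonic w.r.t. any projection removing a set of items `Y`:
for `X ⊆ I \ Y` and any preimage `Z` of `X` (i.e. `Z \ Y = X`), the stability of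
`X` in the projected dataset is at least the stability of `Z` in the original. -/
theorem stab_projection_antimonotonic
    {τ ι : Type*} [Fintype τ] [Fintype ι] [DecidableEq τ] [DecidableEq ι]
    (R : τ → ι → Prop) [∀ t i, Decidable (R t i)]
    (Y X Z : Finset ι) (hX : X ⊆ Finset.univ \ Y) (hZ : Z \ Y = X) :
    stabProj R Y X ≥ stab R Z := by
  subst hZ
  unfold stabProj stab
  apply div_le_div_of_nonneg_right _ (by positivity)
  norm_cast
  apply Finset.card_le_card
  intro S hS
  simp only [Finset.mem_filter, Finset.mem_univ, true_and] at hS ⊢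
  ext i
  have h := Finset.ext_iff.mp hS i
  simp only [dOp, tOp, Finset.mem_sdiff, Finset.mem_filter, Finset.mem_univ, true_and,
    Finset.mem_inter] at h ⊢
  constructor
  · rintro ⟨h1, h2⟩
    exact ⟨h.mp fun t ht => h1 t ⟨fun j hj => ht.1 j hj.1, ht.2⟩, h2⟩
  · rintro ⟨h1, h2⟩
    exact ⟨fun t ht => ht.1 i ⟨h1, h2⟩, h2⟩
end

section
/- Every extent of a projected binary dataset is an extent of the original dataset: let (T, I, R) be a binary dataset with finite sets T and I, let Y ⊆ I, and let A ⊆ T be an extent of the projected dataset (T, I \ Y, R), i.e., t(d(A) \ Y) = A. Then A is an extent of (T, I, R), i.e., t(d(A)) = A. -/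
/-- Every extent of the projected dataset `(T, I \ Y, R)` is an extent of the
original dataset: if `t(d(A) \ Y) = A` then `t(d(A)) = A`. -/
theorem projected_extent_is_extent
    {τ ι : Type*} [Fintype τ] [Fintype ι] [DecidableEq ι]
    (R : τ → ι → Prop) [∀ t i, Decidable (R t i)]
    (Y : Finset ι) (A : Finset τ) (hA : tOp R (dOp R A \ Y) = A) :
    tOp R (dOp R A) = A := by
  apply Finset.Subset.antisymm
  · intro t ht
    have h : t ∈ tOp R (dOp R A \ Y) := by
      simp only [tOp, Finset.mem_filter, Finset.mem_univ, true_and] at ht ⊢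
      exact fun i hi => ht i (Finset.mem_sdiff.mp hi).1
    exact hA ▸ h
  · intro t ht
    simp only [tOp, dOp, Finset.mem_filter, Finset.mem_univ, true_and]
    exact fun i hi => hi t ht
end

section
/- Key inequality for the Δ-measure under projections: let (T, I, R) be a binary dataset with finite sets T and I and let Y ⊆ I. Let E and E_c be extents of the projected dataset (T, I \ Y, R) with E_c ⊊ E, and let E_p be an extent of (T, I, R) that is a preimage of E, i.e., t(d(E_p) \ Y) = E. Then: (i) E_p ∩ E_c is an extent of (T, I, R); (ii) E_p ∩ E_c ⊊ E_p; and (iii) |E_p \ E_c| ≤ |E \ E_c|. -/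
/-- Key inequality for the Δ-measure under projections: let `E` and `E_c` be
extents of the projected dataset `(T, I \ Y, R)` with `E_c ⊊ E`, and let `E_p`
be an extent of `(T, I, R)` that is a preimage of `E` under the induced
projection `ψ_C(A) = t(d(A) \ Y)`. Then (i) `E_p ∩ E_c` is an extent of
`(T, I, R)`, (ii) `E_p ∩ E_c ⊊ E_p`, and (iii) `|E_p \ E_c| ≤ |E \ E_c|`. -/
theorem delta_key_inequality
    {τ ι : Type*} [Fintype τ] [Fintype ι] [DecidableEq τ] [DecidableEq ι]
    (R : τ → ι → Prop) [∀ t i, Decidable (R t i)]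
    (Y : Finset ι) (E Ec Ep : Finset τ)
    (hE : tOp R (dOp R E \ Y) = E)
    (hEc : tOp R (dOp R Ec \ Y) = Ec)
    (hEcE : Ec ⊂ E)
    (hEp : tOp R (dOp R Ep) = Ep)
    (hpre : tOp R (dOp R Ep \ Y) = E) :
    tOp R (dOp R (Ep ∩ Ec)) = Ep ∩ Ec ∧
    Ep ∩ Ec ⊂ Ep ∧
    (Ep \ Ec).card ≤ (E \ Ec).card := by
  have mt : ∀ (A : Finset τ) (x : τ), (x ∈ tOp R (dOp R A) ↔ ∀ i, (∀ t ∈ A, R t i) → R x i) := by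
    intro A x
    simp [tOp, dOp]
  have mY : ∀ (A : Finset τ) (x : τ),
      (x ∈ tOp R (dOp R A \ Y) ↔ ∀ i, (∀ t ∈ A, R t i) → i ∉ Y → R x i) := by
    intro A x
    simp [tOp, dOp]
  have hsub : Ep ⊆ E := by
    intro x hx
    rw [← hpre, mY]
    intro i hi _
    exact hi x hx
  refine ⟨?_, ?_, ?_⟩
  · ext x
    constructor
    · intro hx
      rw [mt] at hx
      rw [Finset.mem_inter]
      constructor
      · rw [← hEp, mt]
        intro i hi
        exact hx i fun t ht => hi t (Finset.mem_inter.1 ht).1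
      · rw [← hEc, mY]
        intro i hi _
        exact hx i fun t ht => hi t (Finset.mem_inter.1 ht).2
    · intro hx
      rw [mt]
      intro i hi
      exact hi x hx
  · refine ⟨Finset.inter_subset_left, fun h => hEcE.2 ?_⟩
    intro x hx
    rw [← hpre, mY] at hx
    rw [← hEc, mY]
    intro i hi hY
    exact hx i (fun t ht => hi t (Finset.mem_inter.1 (h ht)).2) hY
  · exact Finset.card_le_card (Finset.sdiff_subset_sdiff hsub (Finset.Subset.refl _))
end

section
/- The Δ-measure is anti-monotonic with respect to any projection removing a set of items: let (T, I, R) be a binary dataset with finite sets T and I and let Y ⊆ I. Let E be an extent of the projected dataset (T, I \ Y, R) that has at least one extent of the projected dataset strictly contained in it, and let E_p be an extent of (T, I, R) with t(d(E_p) \ Y) = E. Then E_p has at least one extent of (T, I, R) strictly contained in it, and Δ(E_p), computed over the extents of (T, I, R), satisfies Δ(E_p) ≤ Δ'(E), where Δ'(E) is computed over the extents of the projected dataset (T, I \ Y, R). -/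
/-- The Δ-measure of a tidset `A` relative to a collection `ext` of extents:
the minimum of `|A \ A'|` over all extents `A' ⊊ A` (as a `Nat` infimum). -/
noncomputable def deltaMeasure {τ : Type*} [DecidableEq τ]
    (ext : Finset τ → Prop) (A : Finset τ) : ℕ :=
  sInf {n | ∃ A', ext A' ∧ A' ⊂ A ∧ (A \ A').card = n}

/-- The Δ-measure is anti-monotonic w.r.t. any projection removing a set of
items `Y`: if `E` is an extent of the projected dataset `(T, I \ Y, R)` having
some strictly smaller projected extent, and `E_p` is an extent of `(T, I, R)`
with `ψ_C(E_p) = t(d(E_p) \ Y) = E`, then `E_p` has some strictly smaller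
extent of `(T, I, R)` and `Δ(E_p) ≤ Δ'(E)`, where `Δ` is computed over extents
of `(T, I, R)` and `Δ'` over extents of the projected dataset. -/
theorem deltaMeasure_projection_antimonotonic
    {τ ι : Type*} [Fintype τ] [Fintype ι] [DecidableEq τ] [DecidableEq ι]
    (R : τ → ι → Prop) [∀ t i, Decidable (R t i)]
    (Y : Finset ι) (E Ep : Finset τ)
    (hE : tOp R (dOp R E \ Y) = E)
    (hEc : ∃ A, tOp R (dOp R A \ Y) = A ∧ A ⊂ E)
    (hEp : tOp R (dOp R Ep) = Ep)
    (hpre : tOp R (dOp R Ep \ Y) = E) :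
    (∃ A, tOp R (dOp R A) = A ∧ A ⊂ Ep) ∧
    deltaMeasure (fun A => tOp R (dOp R A) = A) Ep ≤
      deltaMeasure (fun A => tOp R (dOp R A \ Y) = A) E := by
  have memd : ∀ (A : Finset τ) i, i ∈ dOp R A ↔ ∀ t ∈ A, R t i := by
    intro A i; simp [dOp]
  have memt : ∀ (X : Finset ι) t, t ∈ tOp R X ↔ ∀ i ∈ X, R t i := by
    intro X t; simp [tOp]
  have key : ∀ A, tOp R (dOp R A \ Y) = A → A ⊂ E →
      tOp R (dOp R (A ∩ Ep)) = A ∩ Ep ∧ A ∩ Ep ⊂ Ep ∧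
        (Ep \ (A ∩ Ep)).card ≤ (E \ A).card := by
    intro A hA hAE
    refine ⟨?_, ?_, ?_⟩
    · apply Finset.Subset.antisymm
      · intro x hx
        rw [memt] at hx
        rw [Finset.mem_inter]
        constructor
        · rw [← hA, memt]
          intro i hi
          apply hx
          rw [memd]
          intro t ht
          exact (memd A i).1 (Finset.mem_sdiff.1 hi).1 t (Finset.mem_inter.1 ht).1
        · rw [← hEp, memt]
          intro i hi
          apply hx
          rw [memd]
          intro t ht
          exact (memd Ep i).1 hi t (Finset.mem_inter.1 ht).2
      · intro x hx
        rw [memt]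
        intro i hi
        exact (memd _ i).1 hi x hx
    · refine ⟨Finset.inter_subset_right, fun h => hAE.2 ?_⟩
      intro x hx
      rw [← hpre, memt] at hx
      rw [← hA, memt]
      intro i hi
      apply hx
      rw [Finset.mem_sdiff, memd] at hi ⊢
      exact ⟨fun t ht => hi.1 t (Finset.mem_inter.1 (h ht)).1, hi.2⟩
    · apply Finset.card_le_card
      intro x hx
      rw [Finset.mem_sdiff, Finset.mem_inter] at hx
      rw [Finset.mem_sdiff]
      refine ⟨?_, fun h => hx.2 ⟨h, hx.1⟩⟩
      rw [← hpre, memt]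
      intro i hi
      exact (memd Ep i).1 (Finset.mem_sdiff.1 hi).1 x hx.1
  obtain ⟨A, hA, hAE⟩ := hEc
  refine ⟨⟨A ∩ Ep, (key A hA hAE).1, (key A hA hAE).2.1⟩, ?_⟩
  unfold deltaMeasure
  obtain ⟨B, hB, hBE, hn⟩ := Nat.sInf_mem
    (s := {n | ∃ A', tOp R (dOp R A' \ Y) = A' ∧ A' ⊂ E ∧ (E \ A').card = n})
    ⟨_, A, hA, hAE, rfl⟩
  obtain ⟨h1, h2, h3⟩ := key B hB hBE
  refine le_trans (Nat.sInf_le ?_) (h3.trans hn.le)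
  exact ⟨B ∩ Ep, h1, h2, rfl⟩
end
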